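/- Let p_1,...,p_n ∈ P^2 be distinct K-points, let J = ∩_i I(p_i) ⊆ K[x_0,x_1,x_2], and let I = J^(m) for some m ≥ 1. If J is generated in degree α(J) (i.e., by forms of degree equal to the least degree of a nonzero form of J), then I^(2r) ⊆ M^r I^r for all r ≥ 1, where M = (x_0,x_1,x_2). -/

import Mathlib

open MvPolynomial
open scoped LinearAlgebra.Projectivization

noncomputable section

/-- The homogeneous vanishing ideal of a point of projective `N`-space:
the ideal generated by all forms vanishing at the point. -/
def pointIdeal {K : Type*} [Field K] {N : ℕ} (q : ℙ K (Fin (N + 1) → K)) :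
    Ideal (MvPolynomial (Fin (N + 1)) K) :=
  Ideal.span {f | (∃ d : ℕ, f.IsHomogeneous d) ∧ MvPolynomial.eval q.rep f = 0}

/-- `α(J)`: the least degree of a nonzero form in `J`. -/
def alphaDeg {σ K : Type*} [CommSemiring K] (J : Ideal (MvPolynomial σ K)) : ℕ :=
  sInf {d : ℕ | ∃ f ∈ J, f ≠ 0 ∧ MvPolynomial.IsHomogeneous f d}

/-- The irrelevant maximal ideal `M = (x_0, …, x_N)` of `K[x_0, …, x_N]`. -/
def irrIdeal (K : Type*) [Field K] (N : ℕ) : Ideal (MvPolynomial (Fin (N + 1)) K) :=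
  Ideal.span (Set.range MvPolynomial.X)

section Cartier

variable {σ k : Type*}

/-- The remainder of an exponent vector modulo `q`. -/
def expMod (q : ℕ) (m : σ →₀ ℕ) : σ →₀ ℕ := m.mapRange (· % q) (Nat.zero_mod q)

/-- The quotient of an exponent vector by `q`. -/
def expDiv (q : ℕ) (m : σ →₀ ℕ) : σ →₀ ℕ := m.mapRange (· / q) (Nat.zero_div q)

lemma expMod_add_smul_expDiv (q : ℕ) (m : σ →₀ ℕ) : expMod q m + q • expDiv q m = m := by
  ext i
  simp [expMod, expDiv, Nat.mod_add_div]

lemma expMod_add_smul (q : ℕ) (m n : σ →₀ ℕ) : expMod q (m + q • n) = expMod q m := by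
  ext i
  simp [expMod]

lemma expDiv_add_smul {q : ℕ} (hq : 0 < q) (m n : σ →₀ ℕ) :
    expDiv q (m + q • n) = expDiv q m + n := by
  ext i
  simp [expDiv, Nat.add_mul_div_left _ _ hq]

open Classical in
/-- The coefficient of `X ^ μ` when `MvPolynomial σ k` is seen as a module over the image of
`MvPolynomial.expand q`, for an exponent vector `μ` with all entries below `q`. -/
def expandCoord [CommRing k] (q : ℕ) (μ : σ →₀ ℕ) : MvPolynomial σ k →ₗ[k] MvPolynomial σ k :=
  (basisMonomials σ k).constr k
    fun m ↦ if expMod q m = μ then monomial (expDiv q m) 1 else 0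

open Classical in
lemma expandCoord_monomial [CommRing k] (q : ℕ) (μ m : σ →₀ ℕ) (c : k) :
    expandCoord q μ (monomial m c) =
      if expMod q m = μ then monomial (expDiv q m) c else 0 := by
  have h : monomial m c = c • basisMonomials σ k m := by
    simp [coe_basisMonomials, smul_monomial]
  rw [h, map_smul, expandCoord, Module.Basis.constr_basis]
  split_ifs <;> simp [smul_monomial]

lemma expandCoord_mul_expand [CommRing k] {q : ℕ} (hq : 0 < q) (μ : σ →₀ ℕ)
    (a h : MvPolynomial σ k) :
    expandCoord q μ (a * expand q h) = expandCoord q μ a * h := by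
  classical
  induction a using MvPolynomial.induction_on' with
  | add a b ha hb => rw [add_mul, map_add, map_add, add_mul, ha, hb]
  | monomial m c =>
    induction h using MvPolynomial.induction_on' with
    | add a b ha hb => rw [map_add, mul_add, map_add, mul_add, ha, hb]
    | monomial n d =>
      rw [expand_monomial, monomial_mul, expandCoord_monomial, expandCoord_monomial,
        expMod_add_smul, expDiv_add_smul hq]
      split_ifs <;> simp [monomial_mul]

/-- The exponent vectors with all entries below `q`. -/
def smallExps (σ : Type*) [Fintype σ] [DecidableEq σ] (q : ℕ) : Finset (σ →₀ ℕ) :=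
  Finset.Iic (Finsupp.equivFunOnFinite.symm fun _ ↦ q - 1)

lemma mem_smallExps [Fintype σ] [DecidableEq σ] {q : ℕ} {μ : σ →₀ ℕ} :
    μ ∈ smallExps σ q ↔ ∀ i, μ i ≤ q - 1 := by
  simp [smallExps, Finsupp.le_def]

lemma sum_monomial_mul_expand_expandCoord [Fintype σ] [DecidableEq σ] [CommRing k] {q : ℕ}
    (hq : 0 < q) (f : MvPolynomial σ k) :
    ∑ μ ∈ smallExps σ q, monomial μ 1 * expand q (expandCoord q μ f) = f := by
  classical
  induction f using MvPolynomial.induction_on' with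
  | add a b ha hb => simp only [map_add, mul_add, Finset.sum_add_distrib, ha, hb]
  | monomial m c =>
    rw [Finset.sum_eq_single (expMod q m)]
    · rw [expandCoord_monomial, if_pos rfl, expand_monomial, monomial_mul, one_mul,
        expMod_add_smul_expDiv]
    · intro μ _ hμ
      rw [expandCoord_monomial, if_neg (Ne.symm hμ), map_zero, mul_zero]
    · intro h
      refine absurd (mem_smallExps.2 fun i ↦ ?_) h
      have := Nat.mod_lt (m i) hq
      simp only [expMod, Finsupp.mapRange_apply]
      omega

lemma coeff_expandCoord [CommRing k] {q : ℕ} (hq : 0 < q) {μ : σ →₀ ℕ} (hμ : ∀ i, μ i < q)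
    (ν : σ →₀ ℕ) (f : MvPolynomial σ k) :
    coeff ν (expandCoord q μ f) = coeff (μ + q • ν) f := by
  classical
  induction f using MvPolynomial.induction_on' with
  | add a b ha hb => rw [map_add, coeff_add, coeff_add, ha, hb]
  | monomial m c =>
    rw [expandCoord_monomial, coeff_monomial]
    have hμ' : expMod q μ = μ := by ext i; simp [expMod, Nat.mod_eq_of_lt (hμ i)]
    have hμ'' : expDiv q μ = 0 := by ext i; simp [expDiv, Nat.div_eq_of_lt (hμ i)]
    by_cases h : m = μ + q • ν
    · subst h
      simp [expMod_add_smul, expDiv_add_smul hq, hμ', hμ'']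
    · rw [if_neg h]
      split_ifs with h1
      · rw [coeff_monomial, if_neg]
        rintro rfl
        exact h (by rw [← h1, expMod_add_smul_expDiv])
      · simp

lemma pow_eq_expand [CommRing k] (p : ℕ) [Fact p.Prime] [CharP k p] (e : ℕ)
    (h : MvPolynomial σ k) :
    h ^ p ^ e = expand (p ^ e) (map (iterateFrobenius k p e) h) := by
  have : iterateFrobenius (MvPolynomial σ k) p e h =
      ((expand (p ^ e)).toRingHom.comp (map (iterateFrobenius k p e))) h := by
    congr 1
    ext
    · simp [iterateFrobenius_def]
    · simp [iterateFrobenius_def]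
  simpa [iterateFrobenius_def] using this

variable [Field k] (p : ℕ) [Fact p.Prime] [CharP k p] [PerfectRing k p] (e : ℕ)

/-- The `p ^ e`-th root of the coordinate of `f` at `X ^ μ`, in the basis given by the monomials
with exponents below `p ^ e` over the subring of `p ^ e`-th powers. -/
def rootCoord (μ : σ →₀ ℕ) (f : MvPolynomial σ k) : MvPolynomial σ k :=
  map (iterateFrobeniusEquiv k p e).symm.toRingHom (expandCoord (p ^ e) μ f)

lemma rootCoord_add (μ : σ →₀ ℕ) (f g : MvPolynomial σ k) :
    rootCoord p e μ (f + g) = rootCoord p e μ f + rootCoord p e μ g := by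
  simp [rootCoord]

lemma rootCoord_zero (μ : σ →₀ ℕ) :
    rootCoord p e μ (0 : MvPolynomial σ k) = 0 := by
  simp [rootCoord]

lemma pos_pow : 0 < p ^ e := pow_pos (Fact.out : p.Prime).pos e

lemma map_symm_map_iterateFrobenius (h : MvPolynomial σ k) :
    map (iterateFrobeniusEquiv k p e).symm.toRingHom (map (iterateFrobenius k p e) h) = h := by
  rw [map_map]
  convert map_id h
  ext x
  exact (iterateFrobeniusEquiv k p e).symm_apply_apply x

lemma map_iterateFrobenius_map_symm (h : MvPolynomial σ k) :
    map (iterateFrobenius k p e) (map (iterateFrobeniusEquiv k p e).symm.toRingHom h) = h := by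
  rw [map_map]
  convert map_id h
  ext x
  exact (iterateFrobeniusEquiv k p e).apply_symm_apply x

lemma rootCoord_mul_pow (μ : σ →₀ ℕ) (a h : MvPolynomial σ k) :
    rootCoord p e μ (a * h ^ p ^ e) = rootCoord p e μ a * h := by
  rw [rootCoord, pow_eq_expand, expandCoord_mul_expand (pos_pow p e), map_mul,
    map_symm_map_iterateFrobenius, rootCoord]

lemma rootCoord_pow (μ : σ →₀ ℕ) (f : MvPolynomial σ k) :
    rootCoord p e μ f ^ p ^ e = expand (p ^ e) (expandCoord (p ^ e) μ f) := by
  rw [pow_eq_expand, rootCoord, map_iterateFrobenius_map_symm]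

lemma sum_monomial_mul_rootCoord_pow [Fintype σ] [DecidableEq σ] (f : MvPolynomial σ k) :
    ∑ μ ∈ smallExps σ (p ^ e), monomial μ 1 * rootCoord p e μ f ^ p ^ e = f := by
  simp only [rootCoord_pow]
  exact sum_monomial_mul_expand_expandCoord (pos_pow p e) f

/-- The Frobenius power of an ideal. -/
abbrev frobPow (I : Ideal (MvPolynomial σ k)) : Ideal (MvPolynomial σ k) :=
  I.map (iterateFrobenius (MvPolynomial σ k) p e)

omit [PerfectRing k p] in
lemma pow_mem_frobPow {I : Ideal (MvPolynomial σ k)} {f : MvPolynomial σ k} (hf : f ∈ I) :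
    f ^ p ^ e ∈ frobPow p e I :=
  Ideal.mem_map_of_mem (iterateFrobenius (MvPolynomial σ k) p e) hf

lemma rootCoord_mem {I : Ideal (MvPolynomial σ k)} {f : MvPolynomial σ k}
    (hf : f ∈ frobPow p e I) (μ : σ →₀ ℕ) : rootCoord p e μ f ∈ I := by
  refine Submodule.span_induction (p := fun f _ ↦ ∀ a, rootCoord p e μ (a * f) ∈ I)
    ?_ ?_ ?_ ?_ hf 1 |> fun h ↦ by simpa using h
  · rintro _ ⟨h, hh, rfl⟩ a
    simp only [iterateFrobenius_def, rootCoord_mul_pow]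
    exact I.mul_mem_left _ hh
  · intro a
    simp [rootCoord_zero]
  · intro f g _ _ hf hg a
    rw [mul_add, rootCoord_add]
    exact I.add_mem (hf a) (hg a)
  · intro b f _ hf a
    rw [smul_eq_mul, ← mul_assoc]
    exact hf _

lemma coeff_rootCoord {μ : σ →₀ ℕ} (hμ : ∀ i, μ i < p ^ e) (ν : σ →₀ ℕ)
    (f : MvPolynomial σ k) :
    coeff ν (rootCoord p e μ f) =
      (iterateFrobeniusEquiv k p e).symm (coeff (μ + p ^ e • ν) f) := by
  rw [rootCoord, coeff_map, coeff_expandCoord (pos_pow p e) hμ]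
  rfl

lemma exists_isHomogeneous_rootCoord {f : MvPolynomial σ k} {d : ℕ} (hf : f.IsHomogeneous d)
    {μ : σ →₀ ℕ} (hμ : ∀ i, μ i < p ^ e) (h0 : rootCoord p e μ f ≠ 0) :
    ∃ c, (rootCoord p e μ f).IsHomogeneous c ∧ μ.degree + p ^ e * c = d := by
  have key : ∀ ν, coeff ν (rootCoord p e μ f) ≠ 0 → μ.degree + p ^ e * ν.degree = d := by
    intro ν hν
    rw [coeff_rootCoord p e hμ] at hν
    have := fun h ↦ hν (by rw [hf.coeff_eq_zero h, map_zero])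
    simpa using not_not.1 this
  obtain ⟨ν, hν⟩ := ne_zero_iff.1 h0
  refine ⟨ν.degree, fun m hm ↦ ?_, key ν hν⟩
  change Finsupp.weight (fun _ ↦ 1) m = _
  rw [← Finsupp.degree_eq_weight_one]
  have := (key m hm).trans (key ν hν).symm
  exact Nat.eq_of_mul_eq_mul_left (pos_pow p e) (by simpa using this)

/-- If `c * f ^ q` lies in the Frobenius power `I^[q]` for all large `q = p ^ e` and a fixed
nonzero `c`, then `f` lies in `I`. -/
lemma mem_of_mul_pow_mem_frobPow {I : Ideal (MvPolynomial σ k)}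
    {c f : MvPolynomial σ k} (hc : c.totalDegree < p ^ e) (hc0 : c ≠ 0)
    (h : c * f ^ p ^ e ∈ frobPow p e I) : f ∈ I := by
  classical
  obtain ⟨μ, hμ⟩ := ne_zero_iff.1 hc0
  have hdeg : ∀ m, coeff m c ≠ 0 → ∀ i, m i < p ^ e := fun m hm i ↦
    ((Finsupp.le_degree i m).trans (le_totalDegree (mem_support_iff.2 hm))).trans_lt hc
  have h1 := rootCoord_mem p e h μ
  rw [rootCoord_mul_pow] at h1
  have h2 : rootCoord p e μ c = C ((iterateFrobeniusEquiv k p e).symm (coeff μ c)) := by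
    ext ν
    rw [coeff_rootCoord p e (hdeg μ hμ), coeff_C]
    split_ifs with h0
    · simp [← h0]
    · rw [map_eq_zero_iff _ (RingEquiv.injective _)]
      by_contra hne
      apply h0
      ext i
      have := hdeg _ hne i
      simp only [Finsupp.add_apply, Finsupp.smul_apply, smul_eq_mul] at this
      by_contra hi
      have hi' : 1 ≤ ν i := Nat.one_le_iff_ne_zero.2 (Ne.symm hi)
      nlinarith [Nat.mul_le_mul_left (p ^ e) hi']
  rw [h2] at h1
  refine (Ideal.unit_mul_mem_iff_mem I ?_).1 h1
  refine (IsUnit.mk0 _ ?_).map C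
  simpa using hμ

end Cartier

section Taylor

variable {σ k : Type*} [CommRing k]

/-- The Taylor expansion `f(X + Y)`, as a polynomial in `Y` over the polynomial ring in `X`. -/
def taylorHom : MvPolynomial σ k →ₐ[k] MvPolynomial σ (MvPolynomial σ k) :=
  aeval fun i ↦ C (X i) + X i

lemma coeff_zero_taylorHom (f : MvPolynomial σ k) : coeff 0 (taylorHom f) = f := by
  induction f using MvPolynomial.induction_on with
  | C a => simp [taylorHom, algebraMap_eq]
  | add a b ha hb => rw [map_add, coeff_add, ha, hb]
  | mul_X a i ha =>
    rw [← constantCoeff_eq] at ha ⊢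
    rw [map_mul, map_mul, ha]
    simp [taylorHom]

lemma coeff_taylorHom_mem {L : Ideal (MvPolynomial σ k)} {t : ℕ} {f : MvPolynomial σ k}
    (hf : f ∈ L ^ t) (μ : σ →₀ ℕ) : coeff μ (taylorHom f) ∈ L ^ (t - μ.degree) := by
  classical
  induction t generalizing f μ with
  | zero => simp
  | succ t ih =>
    rw [pow_succ'] at hf
    induction hf using Submodule.mul_induction_on' with
    | mem_mul_mem a ha b hb =>
      rw [map_mul, coeff_mul]
      refine Ideal.sum_mem _ fun x hx ↦ ?_
      rw [Finset.HasAntidiagonal.mem_antidiagonal] at hx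
      subst hx
      rcases eq_or_ne x.1 0 with h0 | h0
      · rw [h0, coeff_zero_taylorHom, zero_add]
        have := Ideal.mul_mem_mul ha (ih hb x.2)
        rw [← pow_succ'] at this
        exact Ideal.pow_le_pow_right (by omega) this
      · have h1 : x.1.degree ≠ 0 := by rwa [Ne, Finsupp.degree_eq_zero_iff]
        refine Ideal.mul_mem_left _ _ (Ideal.pow_le_pow_right ?_ (ih hb x.2))
        simp only [map_add]
        omega
    | add a _ b _ ha hb =>
      rw [map_add, coeff_add]
      exact Ideal.add_mem _ ha hb

lemma coeff_taylorHom_monomial (μ m : σ →₀ ℕ) :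
    (¬ μ ≤ m → coeff μ (taylorHom (monomial m (1 : k))) = 0) ∧
      coeff m (taylorHom (monomial m (1 : k))) = 1 := by
  classical
  induction m using Finsupp.induction_linear generalizing μ with
  | zero =>
    simp only [nonpos_iff_eq_zero, ← C_apply, map_one]
    refine ⟨fun h ↦ ?_, by simp⟩
    rw [coeff_one, if_neg (Ne.symm h)]
  | add f g hf hg =>
    have hmul : monomial (f + g) (1 : k) = monomial f 1 * monomial g 1 := by
      simp [monomial_mul]
    rw [hmul, map_mul]
    constructor
    · intro h
      rw [coeff_mul]
      refine Finset.sum_eq_zero fun x hx ↦ ?_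
      rw [Finset.HasAntidiagonal.mem_antidiagonal] at hx
      subst hx
      by_cases h1 : x.1 ≤ f
      · by_cases h2 : x.2 ≤ g
        · exact absurd (add_le_add h1 h2) h
        · rw [(hg x.2).1 h2, mul_zero]
      · rw [(hf x.1).1 h1, zero_mul]
    · rw [coeff_mul, Finset.sum_eq_single (f, g)]
      · rw [(hf 0).2, (hg 0).2, one_mul]
      · intro x hx hne
        rw [Finset.HasAntidiagonal.mem_antidiagonal] at hx
        by_cases h1 : x.1 ≤ f
        · by_cases h2 : x.2 ≤ g
          · refine absurd (Prod.ext ?_ ?_) hne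
            · ext i
              have := DFunLike.congr_fun hx i
              have := h1 i
              have := h2 i
              simp only [Finsupp.add_apply] at *
              omega
            · ext i
              have := DFunLike.congr_fun hx i
              have := h1 i
              have := h2 i
              simp only [Finsupp.add_apply] at *
              omega
          · rw [(hg x.2).1 h2, mul_zero]
        · rw [(hf x.1).1 h1, zero_mul]
      · simp
  | single i n =>
    induction n generalizing μ with
    | zero =>
      simp only [Finsupp.single_zero, nonpos_iff_eq_zero, ← C_apply, map_one]
      refine ⟨fun h ↦ ?_, by simp⟩
      rw [coeff_one, if_neg (Ne.symm h)]
    | succ n ih =>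
      have hmul : monomial (Finsupp.single i (n + 1)) (1 : k) =
          monomial (Finsupp.single i n) 1 * X i := by
        simp [X, monomial_mul]
      have hT : taylorHom (X i : MvPolynomial σ k) = C (X i) + X i := by simp [taylorHom]
      rw [hmul, map_mul, hT, mul_add, mul_comm _ (C (X i))]
      simp only [coeff_add, coeff_C_mul, coeff_mul_X']
      constructor
      · intro h
        rw [(ih μ).1, mul_zero, zero_add]
        · split_ifs with hi
          · refine (ih _).1 fun h' ↦ h ?_
            rw [tsub_le_iff_right, ← Finsupp.single_add] at h'
            exact h'
          · rfl
        · exact fun h' ↦ h (h'.trans (Finsupp.single_mono (Nat.le_succ n)))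
      · rw [(ih (Finsupp.single i (n + 1))).1, mul_zero, zero_add, if_pos]
        · convert (ih 0).2 using 2
          rw [Finsupp.single_add, add_tsub_cancel_right]
        · simp
        · simp

lemma coeff_single_taylorHom (j : σ) (f : MvPolynomial σ k) :
    coeff (Finsupp.single j 1) (taylorHom f) = pderiv j f := by
  classical
  induction f using MvPolynomial.induction_on with
  | C a =>
    rw [taylorHom, algHom_C, MvPolynomial.algebraMap_apply, coeff_C, pderiv_C,
      if_neg (by simp [eq_comm])]
  | add a b ha hb => rw [map_add, coeff_add, ha, hb, map_add]
  | mul_X a i ha =>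
    have hT : taylorHom (X i : MvPolynomial σ k) = C (X i) + X i := by simp [taylorHom]
    rw [map_mul, hT, mul_add, mul_comm _ (C (X i)), coeff_add, coeff_C_mul, coeff_mul_X', ha,
      Derivation.leibniz,
      pderiv_X, smul_eq_mul, smul_eq_mul, add_comm]
    congr 1
    rcases eq_or_ne i j with rfl | h
    · simp [coeff_zero_taylorHom]
    · rw [if_neg, Pi.single_eq_of_ne h, mul_zero]
      simpa using h

variable (p : ℕ) [Fact p.Prime] [CharP k p] (e : ℕ)

lemma coeff_pow_of_degree_lt {h : MvPolynomial σ k} {ν : σ →₀ ℕ} (h0 : ν ≠ 0)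
    (hν : ν.degree < p ^ e) : coeff ν (h ^ p ^ e) = 0 := by
  rw [pow_eq_expand]
  obtain ⟨i, hi⟩ := Finsupp.ne_iff.1 h0
  refine coeff_expand_of_not_dvd _ (i := i) fun hd ↦ ?_
  have := Nat.le_of_dvd (Nat.pos_of_ne_zero hi) hd
  have := Finsupp.le_degree i ν
  omega

lemma coeff_taylorHom_mul_pow {μ : σ →₀ ℕ} (hμ : μ.degree < p ^ e) (a h : MvPolynomial σ k) :
    coeff μ (taylorHom (a * h ^ p ^ e)) = coeff μ (taylorHom a) * h ^ p ^ e := by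
  classical
  rw [map_mul, map_pow, coeff_mul, Finset.sum_eq_single (μ, 0)]
  · have : coeff 0 (taylorHom h ^ p ^ e) = coeff 0 (taylorHom h) ^ p ^ e := by
      simp only [← constantCoeff_eq, map_pow]
    rw [this, coeff_zero_taylorHom]
  · intro x hx hne
    rw [Finset.HasAntidiagonal.mem_antidiagonal] at hx
    rw [coeff_pow_of_degree_lt, mul_zero]
    · intro h0
      exact hne (Prod.ext (by simpa [h0] using hx) h0)
    · rw [← hx, map_add] at hμ
      omega
  · simp

lemma pderiv_pow_mem {L : Ideal (MvPolynomial σ k)} {g : MvPolynomial σ k}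
    (hg : g ^ p ^ e ∈ L ^ (p ^ e + 1)) (j : σ) : pderiv j g ^ p ^ e ∈ L := by
  have h := coeff_taylorHom_mem hg (p ^ e • Finsupp.single j 1)
  rw [map_pow, pow_eq_expand, coeff_expand_smul _ (pow_pos (Fact.out : p.Prime).pos e).ne',
    coeff_map, iterateFrobenius_def, coeff_single_taylorHom] at h
  simpa using h

end Taylor

section VanishingIdeal

variable {σ ι k : Type*} [CommRing k]

/-- The ideal generated by the forms of degree at most `b` that vanish at all points `v i`. -/
def formIdeal (b : ℕ) (v : ι → σ → k) : Ideal (MvPolynomial σ k) :=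
  Ideal.span {g | ∃ c ≤ b, g.IsHomogeneous c ∧ ∀ i, eval (v i) g = 0}

end VanishingIdeal

section CharP

variable {σ ι k : Type*} [Field k] (p : ℕ) [Fact p.Prime] [CharP k p] [PerfectRing k p]

include p in
lemma eq_zero_of_pderiv_eq_zero [Fintype σ] {v : ι → σ → k} {α : ℕ} (hα0 : 1 ≤ α)
    (hα : ∀ c < α, ∀ g : MvPolynomial σ k, g.IsHomogeneous c → (∀ i, eval (v i) g = 0) → g = 0)
    {g : MvPolynomial σ k} (hg : g.IsHomogeneous α) (hgv : ∀ i, eval (v i) g = 0)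
    (hd : ∀ j, pderiv j g = 0) : g = 0 := by
  classical
  have hp : p.Prime := Fact.out
  have hlt : ∀ {μ : σ →₀ ℕ}, μ ∈ smallExps σ (p ^ 1) → ∀ i, μ i < p ^ 1 := fun hμ i ↦ by
    have := mem_smallExps.1 hμ i
    have := pos_pow p 1
    omega
  have h0 : ∀ μ ∈ smallExps σ (p ^ 1), μ ≠ 0 → rootCoord p 1 μ g = 0 := by
    intro μ hμ hne
    obtain ⟨i, hi⟩ := Finsupp.ne_iff.1 hne
    ext ν
    rw [coeff_rootCoord p 1 (hlt hμ), coeff_zero, map_eq_zero_iff _ (RingEquiv.injective _)]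
    have h1 := congrArg (coeff (μ + p ^ 1 • ν - Finsupp.single i 1)) (hd i)
    have hle : Finsupp.single i 1 ≤ μ + p ^ 1 • ν := by
      rw [Finsupp.single_le_iff]
      have : 0 < μ i := Nat.pos_of_ne_zero hi
      simp only [Finsupp.add_apply]
      omega
    rw [coeff_pderiv, tsub_add_cancel_of_le hle, coeff_zero, ← Nat.cast_add_one] at h1
    refine (mul_eq_zero.1 h1).resolve_right fun h2 ↦ ?_
    have h3 : (μ + p ^ 1 • ν - Finsupp.single i 1 : σ →₀ ℕ) i + 1 = μ i + p * ν i := by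
      have := Finsupp.single_le_iff.1 hle
      simp only [Finsupp.tsub_apply, Finsupp.single_eq_same] at *
      rw [Nat.sub_add_cancel this]
      simp
    rw [h3, CharP.cast_eq_zero_iff k p, Nat.dvd_add_left (dvd_mul_right p _)] at h2
    have := Nat.le_of_dvd (Nat.pos_of_ne_zero hi) h2
    have := hlt hμ i
    simp at this
    omega
  have h1 := sum_monomial_mul_rootCoord_pow p 1 g
  rw [Finset.sum_eq_single 0 (fun μ hμ hne ↦ by
    rw [h0 μ hμ hne, zero_pow (pos_pow p 1).ne', mul_zero])
    (fun h ↦ absurd (mem_smallExps.2 (by simp)) h), ← C_apply, C_1, one_mul] at h1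
  by_contra hne
  have hr : rootCoord p 1 0 g ≠ 0 := by
    intro h
    rw [h, zero_pow (pos_pow p 1).ne'] at h1
    exact hne h1.symm
  obtain ⟨c, hc, hcd⟩ := exists_isHomogeneous_rootCoord p 1 hg (fun i ↦ pos_pow p 1) hr
  refine hr (hα c ?_ _ hc fun i ↦ ?_)
  · have := hp.two_le
    simp only [map_zero, zero_add, pow_one] at hcd
    nlinarith
  · have := hgv i
    rw [← h1, map_pow] at this
    exact pow_eq_zero_iff (pos_pow p 1).ne' |>.1 this

variable {v : ι → σ → k} {L : ι → Ideal (MvPolynomial σ k)}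
  (hLv : ∀ i, ∀ f ∈ L i, eval (v i) f = 0)
  (hL : ∀ i e, L i ^ (2 * p ^ e) ≤ frobPow p e (L i))

include hLv hL

lemma le_degree_of_mem_pow_two_mul_prime_pow [Fintype σ] {α : ℕ} (hα0 : 1 ≤ α)
    (hα : ∀ c < α, ∀ g : MvPolynomial σ k, g.IsHomogeneous c → (∀ i, eval (v i) g = 0) → g = 0)
    {e d : ℕ} {f : MvPolynomial σ k} (hf : f.IsHomogeneous d) (hf0 : f ≠ 0)
    (hfL : ∀ i, f ∈ L i ^ (2 * p ^ e)) : p ^ e * (α + 1) ≤ d := by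
  classical
  have hlt : ∀ {μ : σ →₀ ℕ}, μ ∈ smallExps σ (p ^ e) → ∀ i, μ i < p ^ e := fun hμ i ↦ by
    have := mem_smallExps.1 hμ i
    have := pos_pow p e
    omega
  have hsum := sum_monomial_mul_rootCoord_pow p e f
  set U := (smallExps σ (p ^ e)).filter fun μ ↦ rootCoord p e μ f ≠ 0 with hU
  have hUne : U.Nonempty := by
    by_contra h
    rw [Finset.not_nonempty_iff_eq_empty, hU, Finset.filter_eq_empty_iff] at h
    refine hf0 (hsum ▸ Finset.sum_eq_zero fun μ hμ ↦ ?_)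
    rw [not_not.1 (h hμ), zero_pow (pos_pow p e).ne', mul_zero]
  obtain ⟨μ, hμU, hmax⟩ := U.exists_max_image (fun μ ↦ μ.degree) hUne
  obtain ⟨hμ, hg0⟩ := Finset.mem_filter.1 hμU
  set g := rootCoord p e μ f with hg
  obtain ⟨c, hc, hcd⟩ := exists_isHomogeneous_rootCoord p e hf (hlt hμ) hg0
  have hgv : ∀ i, eval (v i) g = 0 := fun i ↦
    hLv i _ (rootCoord_mem p e (hL i e (hfL i)) μ)
  have hαc : α ≤ c := by
    by_contra h
    exact hg0 (hα c (not_le.1 h) g hc hgv)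
  rcases le_or_gt (p ^ e) μ.degree with h | h
  · nlinarith [Nat.mul_le_mul_left (p ^ e) hαc]
  rcases hαc.lt_or_eq with h' | rfl
  · nlinarith [Nat.mul_le_mul_left (p ^ e) h']
  have hcoeff : coeff μ (taylorHom f) = g ^ p ^ e := by
    rw [← hsum, map_sum, coeff_sum, Finset.sum_eq_single μ]
    · rw [coeff_taylorHom_mul_pow p e h, (coeff_taylorHom_monomial μ μ).2, one_mul]
    · intro μ' hμ' hne
      rw [coeff_taylorHom_mul_pow p e h]
      by_cases h0 : rootCoord p e μ' f = 0
      · rw [h0, zero_pow (pos_pow p e).ne', mul_zero]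
      · rw [(coeff_taylorHom_monomial μ μ').1, zero_mul]
        intro hle
        have h1 := hmax μ' (Finset.mem_filter.2 ⟨hμ', h0⟩)
        obtain ⟨ν, rfl⟩ := exists_add_of_le hle
        simp only [map_add, add_le_iff_nonpos_right, nonpos_iff_eq_zero,
          Finsupp.degree_eq_zero_iff] at h1
        exact hne (by rw [h1, add_zero])
    · exact fun h ↦ absurd hμ h
  refine absurd (eq_zero_of_pderiv_eq_zero p hα0 hα hc hgv fun j ↦ ?_) hg0
  refine hα _ (Nat.sub_lt hα0 one_pos) _ hc.pderiv fun i ↦ ?_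
  have h1 := coeff_taylorHom_mem (hfL i) μ
  rw [hcoeff] at h1
  have h2 := hLv i _ (pderiv_pow_mem p e (Ideal.pow_le_pow_right (by omega) h1) j)
  rw [map_pow] at h2
  exact pow_eq_zero_iff (pos_pow p e).ne' |>.1 h2

lemma le_degree_of_mem_pow_two_mul [Fintype σ] {α : ℕ} (hα0 : 1 ≤ α)
    (hα : ∀ c < α, ∀ g : MvPolynomial σ k, g.IsHomogeneous c → (∀ i, eval (v i) g = 0) → g = 0)
    {r d : ℕ} (hr : 1 ≤ r) {f : MvPolynomial σ k} (hf : f.IsHomogeneous d) (hf0 : f ≠ 0)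
    (hfL : ∀ i, f ∈ L i ^ (2 * r)) : r * (α + 1) ≤ d := by
  by_contra! hlt
  obtain ⟨e, he⟩ : ∃ e, r * d < p ^ e := ⟨_, Nat.lt_pow_self (Fact.out : p.Prime).one_lt⟩
  set s := p ^ e / r + 1 with hs
  have hrs : p ^ e ≤ r * s := by
    have := Nat.div_add_mod (p ^ e) r
    have := Nat.mod_lt (p ^ e) hr
    rw [hs, mul_add]
    omega
  have hrs' : r * s ≤ p ^ e + r := by
    have := Nat.mul_div_le (p ^ e) r
    rw [hs, mul_add]
    omega
  have h := le_degree_of_mem_pow_two_mul_prime_pow p hLv hL hα0 hα (hf.pow s)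
    (pow_ne_zero s hf0) (e := e) fun i ↦ by
      have := Ideal.pow_mem_pow (hfL i) s
      rw [← pow_mul] at this
      exact Ideal.pow_le_pow_right (by nlinarith) this
  have h1 : r * (p ^ e * (α + 1)) ≤ (p ^ e + r) * d := by
    calc r * (p ^ e * (α + 1)) ≤ r * (d * s) := Nat.mul_le_mul_left r h
      _ = (r * s) * d := by ring
      _ ≤ _ := Nat.mul_le_mul_right d hrs'
  nlinarith [Nat.mul_le_mul_left (p ^ e) hlt]

lemma mem_formIdeal_pow_of_mem_pow_two_mul [Fintype σ]
    {r d : ℕ} (hr : 1 ≤ r) {f : MvPolynomial σ k} (hf : f.IsHomogeneous d)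
    (hfL : ∀ i, f ∈ L i ^ (2 * r)) : f ∈ formIdeal d v ^ r := by
  classical
  rcases eq_or_ne f 0 with rfl | hf0
  · exact Ideal.zero_mem _
  obtain ⟨e, he⟩ : ∃ e, d * r < p ^ e := ⟨_, Nat.lt_pow_self (Fact.out : p.Prime).one_lt⟩
  set s := p ^ e / r + 1 with hs
  have hrs : p ^ e ≤ r * s := by
    have := Nat.div_add_mod (p ^ e) r
    have := Nat.mod_lt (p ^ e) hr
    rw [hs, mul_add]
    omega
  have hrs' : r * s ≤ p ^ e + r := by
    have := Nat.mul_div_le (p ^ e) r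
    rw [hs, mul_add]
    omega
  have hfs : f ^ s ∈ frobPow p e (formIdeal d v) := by
    have hmem : ∀ i, f ^ s ∈ frobPow p e (L i) := fun i ↦ by
      have := Ideal.pow_mem_pow (hfL i) s
      rw [← pow_mul] at this
      exact hL i e (Ideal.pow_le_pow_right (by nlinarith) this)
    rw [← sum_monomial_mul_rootCoord_pow p e (f ^ s)]
    refine Ideal.sum_mem _ fun μ hμ ↦ Ideal.mul_mem_left _ _ (pow_mem_frobPow p e ?_)
    by_cases h0 : rootCoord p e μ (f ^ s) = 0
    · rw [h0]
      exact Ideal.zero_mem _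
    have hlt : ∀ i, μ i < p ^ e := fun i ↦ by
      have := mem_smallExps.1 hμ i
      have := pos_pow p e
      omega
    obtain ⟨c, hc, hcd⟩ := exists_isHomogeneous_rootCoord p e (hf.pow s) hlt h0
    refine Ideal.subset_span ⟨c, ?_, hc, fun i ↦ hLv i _ (rootCoord_mem p e (hmem i) μ)⟩
    have hs' : s ≤ p ^ e + 1 := Nat.add_le_add_right (Nat.div_le_self _ _) 1
    have h1 : p ^ e * c ≤ d * (p ^ e + 1) :=
      le_trans (by omega) (Nat.mul_le_mul_left d hs')
    have h2 : d ≤ d * r := Nat.le_mul_of_pos_right d hr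
    by_contra! hlt'
    nlinarith [Nat.mul_le_mul_left (p ^ e) hlt']
  refine mem_of_mul_pow_mem_frobPow p e (c := f ^ r) ?_ (pow_ne_zero r hf0) ?_
  · rw [(hf.pow r).totalDegree (pow_ne_zero r hf0)]
    exact he
  · have h1 := Ideal.pow_mem_pow hfs r
    rw [← Ideal.map_pow, ← pow_mul] at h1
    rw [← pow_add, ← Nat.sub_add_cancel (show s * r ≤ r + p ^ e by linarith), pow_add]
    exact Ideal.mul_mem_left _ _ h1

end CharP

section PointIdeal

variable {σ D : Type*} [CommRing D]

/-- The ideal generated by the linear forms `x_l - w_l x_j`; when `w_j = 1` it is the homogeneous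
ideal of the projective point with coordinates `w`. -/
def lineIdeal (w : σ → D) (j : σ) : Ideal (MvPolynomial σ D) :=
  Ideal.span (Set.range fun l ↦ X l - C (w l) * X j)

lemma eval_eq_zero_of_mem_lineIdeal {w : σ → D} {j : σ} (hw : w j = 1) {f : MvPolynomial σ D}
    (hf : f ∈ lineIdeal w j) : eval w f = 0 := by
  have : lineIdeal w j ≤ RingHom.ker (eval w) := by
    rw [lineIdeal, Ideal.span_le]
    rintro _ ⟨l, rfl⟩
    simp [RingHom.mem_ker, hw]
  exact this hf

lemma map_lineIdeal {k : Type*} [CommRing k] (φ : D →+* k) (w : σ → D) (j : σ) :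
    (lineIdeal w j).map (map φ) = lineIdeal (φ ∘ w) j := by
  rw [lineIdeal, lineIdeal, Ideal.map_span, ← Set.range_comp]
  congr 2
  ext1 l
  simp

lemma sub_mem_lineIdeal (w : σ → D) (j : σ) (f : MvPolynomial σ D) :
    f - aeval (fun l ↦ C (w l) * X j) f ∈ lineIdeal w j := by
  rw [← Ideal.Quotient.eq]
  let φ : MvPolynomial σ D →ₐ[D] MvPolynomial σ D ⧸ lineIdeal w j :=
    Ideal.Quotient.mkₐ D (lineIdeal w j)
  have : φ = φ.comp (aeval fun l ↦ C (w l) * X j) := by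
    ext l
    simp only [AlgHom.comp_apply, aeval_X]
    exact Ideal.Quotient.eq.2 (Ideal.subset_span ⟨l, rfl⟩)
  exact DFunLike.congr_fun this f

lemma mem_lineIdeal_of_isHomogeneous {w : σ → D} (j : σ) {f : MvPolynomial σ D}
    {d : ℕ} (hf : f.IsHomogeneous d) (h : eval w f = 0) : f ∈ lineIdeal w j := by
  have h1 := sub_mem_lineIdeal w j f
  have h2 : aeval (fun l ↦ C (w l) * X j) f = C (eval w f) * (X j : MvPolynomial σ D) ^ d := by
    rw [eval_eq, map_sum, Finset.sum_mul, aeval_def, eval₂_eq, algebraMap_eq]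
    refine Finset.sum_congr rfl fun m hm ↦ ?_
    have hd : ∑ i ∈ m.support, m i = d := by
      rw [← Finsupp.degree_apply]
      exact not_not.1 fun h ↦ mem_support_iff.1 hm (hf.coeff_eq_zero h)
    simp only [mul_pow, Finset.prod_mul_distrib, map_mul, map_prod, map_pow, ← hd,
      Finset.prod_pow_eq_pow_sum, mul_assoc]
  rwa [h2, h, map_zero, zero_mul, sub_zero] at h1

lemma pow_two_mul_le_frobPow {k : Type*} [Field k] (p : ℕ) [Fact p.Prime] [CharP k p]
    {w : Fin 3 → k} {j : Fin 3} (hw : w j = 1) (e : ℕ) :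
    lineIdeal w j ^ (2 * p ^ e) ≤ frobPow p e (lineIdeal w j) := by
  have hmem : ∀ l, X l - C (w l) * X j ∈ lineIdeal w j := fun l ↦ Ideal.subset_span ⟨l, rfl⟩
  have key : ∃ a ∈ lineIdeal w j, ∃ b ∈ lineIdeal w j,
      lineIdeal w j ≤ Ideal.span {a} ⊔ Ideal.span {b} := by
    refine ⟨_, hmem (j + 1), _, hmem (j + 2), ?_⟩
    rw [lineIdeal, Ideal.span_le]
    rintro _ ⟨l, rfl⟩
    have hl : l = j ∨ l = j + 1 ∨ l = j + 2 := by
      clear hw hmem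
      revert l j
      decide
    rcases hl with rfl | rfl | rfl
    · simp [hw]
    · exact Ideal.mem_sup_left (Ideal.mem_span_singleton_self _)
    · exact Ideal.mem_sup_right (Ideal.mem_span_singleton_self _)
  obtain ⟨a, ha, b, hb, hab⟩ := key
  refine (Ideal.pow_right_mono hab _).trans ?_
  rw [two_mul]
  refine Ideal.sup_pow_add_le_pow_sup_pow.trans ?_
  rw [Ideal.span_singleton_pow, Ideal.span_singleton_pow, sup_le_iff,
    Ideal.span_singleton_le_iff_mem, Ideal.span_singleton_le_iff_mem]
  exact ⟨pow_mem_frobPow p e ha, pow_mem_frobPow p e hb⟩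

/-- The linear change of coordinates moving the point `w` to the `j`-th coordinate point. -/
def shiftHom [DecidableEq σ] (w : σ → D) (j : σ) : MvPolynomial σ D →ₐ[D] MvPolynomial σ D :=
  aeval fun l ↦ if l = j then X j else X l + C (w l) * X j

/-- The inverse of `shiftHom`. -/
def unshiftHom [DecidableEq σ] (w : σ → D) (j : σ) : MvPolynomial σ D →ₐ[D] MvPolynomial σ D :=
  aeval fun l ↦ if l = j then X j else X l - C (w l) * X j

lemma unshiftHom_shiftHom [DecidableEq σ] (w : σ → D) (j : σ) (f : MvPolynomial σ D) :
    unshiftHom w j (shiftHom w j f) = f := by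
  have : (unshiftHom w j).comp (shiftHom w j) = AlgHom.id D _ := by
    ext l : 1
    by_cases h : l = j <;> simp [unshiftHom, shiftHom, h, algebraMap_eq]
  exact DFunLike.congr_fun this f

lemma map_shiftHom [DecidableEq σ] {k : Type*} [CommRing k] (φ : D →+* k) (w : σ → D) (j : σ)
    (f : MvPolynomial σ D) : map φ (shiftHom w j f) = shiftHom (φ ∘ w) j (map φ f) := by
  induction f using MvPolynomial.induction_on with
  | C a => simp [shiftHom, algebraMap_eq]
  | add a b ha hb => simp [ha, hb]
  | mul_X a i ha =>
    rw [map_mul, map_mul, ha, map_mul, map_mul]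
    congr 1
    by_cases h : i = j <;> simp [shiftHom, h]

lemma add_le_degree_of_mem_lineIdeal_pow [DecidableEq σ] {w : σ → D} {j : σ} (hw : w j = 1)
    {t : ℕ} {f : MvPolynomial σ D} (hf : f ∈ lineIdeal w j ^ t) {m : σ →₀ ℕ}
    (hm : coeff m (shiftHom w j f) ≠ 0) : t + m j ≤ m.degree := by
  induction t generalizing f m with
  | zero => simpa using Finsupp.le_degree j m
  | succ t ih =>
    rw [pow_succ'] at hf
    revert hm
    contrapose!
    intro hm
    induction hf using Submodule.mul_induction_on' with
    | mem_mul_mem a ha b hb =>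
      rw [map_mul, coeff_mul]
      refine Finset.sum_eq_zero fun x hx ↦ ?_
      rw [Finset.HasAntidiagonal.mem_antidiagonal] at hx
      subst hx
      by_contra hne
      have h1 := ih hb (right_ne_zero_of_mul hne)
      have h2 : shiftHom w j a ∈ Ideal.span (X '' {l | l ≠ j}) := by
        have : lineIdeal w j ≤ (Ideal.span (X '' {l | l ≠ j})).comap (shiftHom w j) := by
          rw [lineIdeal, Ideal.span_le]
          rintro _ ⟨l, rfl⟩
          by_cases h : l = j
          · simp [shiftHom, h, hw]
          · simp only [shiftHom, SetLike.mem_coe, Ideal.mem_comap, map_sub, map_mul, aeval_X,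
              algHom_C, algebraMap_eq, if_neg h, if_pos, add_sub_cancel_right]
            exact Ideal.subset_span ⟨l, h, rfl⟩
        exact this ha
      rw [mem_ideal_span_X_image] at h2
      obtain ⟨i, hi, hi'⟩ := h2 x.1 (mem_support_iff.2 (left_ne_zero_of_mul hne))
      have h3 : x.1 j + 1 ≤ x.1.degree := by
        have : Finsupp.single j (x.1 j) + Finsupp.single i 1 ≤ x.1 := by
          intro l
          by_cases h : l = j
          · subst h
            simp [show i ≠ l from hi]
          · by_cases h' : l = i
            · subst h'
              simp [Ne.symm h, Nat.one_le_iff_ne_zero, hi']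
            · simp [Ne.symm h, Ne.symm h']
        simpa using Finsupp.degree_mono this
      simp only [map_add, Finsupp.add_apply] at hm
      omega
    | add a _ b _ ha hb => rw [map_add, coeff_add, ha, hb, add_zero]

lemma mem_lineIdeal_pow [Fintype σ] [DecidableEq σ] {w : σ → D} {j : σ}
    {t : ℕ} {f : MvPolynomial σ D}
    (h : ∀ m, coeff m (shiftHom w j f) ≠ 0 → t + m j ≤ m.degree) :
    f ∈ lineIdeal w j ^ t := by
  rw [← unshiftHom_shiftHom w j f]
  generalize shiftHom w j f = g at h
  rw [g.as_sum, map_sum]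
  refine Ideal.sum_mem _ fun m hm ↦ ?_
  have h1 := h m (mem_support_iff.1 hm)
  rw [unshiftHom, aeval_monomial, Finsupp.prod_fintype _ _ (by simp),
    ← Finset.prod_erase_mul _ _ (Finset.mem_univ j)]
  refine Ideal.mul_mem_left _ _ (Ideal.mul_mem_right _ _ ?_)
  have h2 : ∏ l ∈ Finset.univ.erase j,
      (if l = j then X j else X l - C (w l) * X j : MvPolynomial σ D) ^ m l ∈
      ∏ l ∈ Finset.univ.erase j, lineIdeal w j ^ m l := by
    refine Ideal.prod_mem_prod fun l hl ↦ Ideal.pow_mem_pow ?_ _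
    rw [if_neg (Finset.ne_of_mem_erase hl)]
    exact Ideal.subset_span ⟨l, rfl⟩
  rw [Finset.prod_pow_eq_pow_sum] at h2
  refine Ideal.pow_le_pow_right ?_ h2
  rw [Finsupp.degree_eq_sum, ← Finset.sum_erase_add _ _ (Finset.mem_univ j)] at h1
  omega

/-- Membership in a power of the ideal of a point descends along injective ring maps. -/
lemma mem_lineIdeal_pow_of_map_mem [Fintype σ] {K : Type*} [CommRing K] {ι : D →+* K}
    (hι : Function.Injective ι) {w : σ → D} {j : σ} (hw : w j = 1) {t : ℕ}
    {f : MvPolynomial σ D} (hf : map ι f ∈ lineIdeal (ι ∘ w) j ^ t) :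
    f ∈ lineIdeal w j ^ t := by
  classical
  refine mem_lineIdeal_pow fun m hm ↦ ?_
  refine add_le_degree_of_mem_lineIdeal_pow (w := ι ∘ w) (by simp [hw]) hf ?_
  rw [← map_shiftHom, coeff_map]
  exact (map_ne_zero_iff _ hι).2 hm

end PointIdeal

section Specialization

universe u

lemma isJacobsonRing_int : IsJacobsonRing ℤ := by
  rw [isJacobsonRing_iff_prime_eq]
  intro P hP
  by_cases h : P = ⊥
  · subst h
    refine le_antisymm (fun x hx ↦ ?_) Ideal.le_jacobson
    have h1 := Int.isUnit_iff.1 (Ideal.mem_jacobson_bot.1 hx (3 * x))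
    have h2 : x = 0 := by
      rcases h1 with h1 | h1 <;> nlinarith [sq_nonneg x]
    simp [h2]
  · have := hP.isMaximal h
    exact Ideal.jacobson_eq_self_of_isMaximal

/-- A nonzero ring of finite type over `ℤ` maps to a perfect field of positive characteristic. -/
lemma exists_ringHom_perfectRing (D : Type u) [CommRing D] [Nontrivial D]
    [Algebra.FiniteType ℤ D] :
    ∃ (k : Type u) (_ : Field k) (p : ℕ) (_ : Fact p.Prime) (_ : CharP k p) (_ : PerfectRing k p),
      Nonempty (D →+* k) := by
  obtain ⟨P, hP⟩ := Ideal.exists_maximal D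
  let F := D ⧸ P
  let hF : Field F := Ideal.Quotient.field P
  have := isJacobsonRing_int
  have : Algebra.FiniteType ℤ F := Algebra.FiniteType.of_surjective
    (Ideal.Quotient.mkₐ ℤ P) (Ideal.Quotient.mkₐ_surjective ℤ P)
  have : Module.Finite ℤ F := finite_of_finite_type_of_isJacobsonRing ℤ F
  obtain ⟨p, hp⟩ := CharP.exists F
  have hprime : p.Prime := by
    refine (CharP.char_is_prime_or_zero F p).resolve_right ?_
    rintro rfl
    have := CharP.charP_to_charZero F
    exact Int.not_isField (isField_of_isIntegral_of_isField (S := F)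
      (RingHom.injective_int _) (Field.toIsField F))
  have hfact := Fact.mk hprime
  have hchar : CharP (AlgebraicClosure F) p :=
    charP_of_injective_algebraMap (algebraMap F (AlgebraicClosure F)).injective p
  exact ⟨AlgebraicClosure F, inferInstance, p, hfact, hchar, PerfectField.toPerfectRing p,
    ⟨(algebraMap F (AlgebraicClosure F)).comp (Ideal.Quotient.mk P)⟩⟩

variable {σ ι : Type*}

/-- The matrix of evaluations of the monomials in `T` at the points `v i`. -/
def evalMatrix {D : Type*} [CommRing D] (v : ι → σ → D) (T : Finset (σ →₀ ℕ)) : Matrix ι T D :=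
  Matrix.of fun i m ↦ eval (v i) (monomial m.1 1)

lemma evalMatrix_map {D k : Type*} [CommRing D] [CommRing k] (φ : D →+* k) (v : ι → σ → D)
    (T : Finset (σ →₀ ℕ)) :
    (evalMatrix v T).map φ = evalMatrix (fun i ↦ φ ∘ v i) T := by
  ext i m
  simp [evalMatrix, map_eval]

lemma sum_evalMatrix_mul {D : Type*} [CommRing D] (v : ι → σ → D) (T : Finset (σ →₀ ℕ))
    (c : T → D) (i : ι) :
    eval (v i) (∑ m : T, monomial m.1 (c m)) = ∑ m, evalMatrix v T i m * c m := by
  rw [map_sum]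
  refine Finset.sum_congr rfl fun m _ ↦ ?_
  rw [evalMatrix, Matrix.of_apply, mul_comm, ← smul_eval, smul_monomial, smul_eq_mul, mul_one]

lemma exists_mul_mul_eq {K m n : Type*} [Field K] [Fintype m] [Fintype n]
    (A : Matrix m n K) : ∃ B : Matrix n m K, A * B * A = A := by
  classical
  let f := Matrix.toLin' A
  obtain ⟨g, hg⟩ := f.rangeRestrict.exists_rightInverse_of_surjective f.range_rangeRestrict
  obtain ⟨h, hh⟩ := LinearMap.exists_extend g
  refine ⟨LinearMap.toMatrix' h, Matrix.toLin'.injective ?_⟩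
  ext1 x
  rw [Matrix.toLin'_mul, Matrix.toLin'_mul, Matrix.toLin'_toMatrix']
  ext1
  simp only [LinearMap.comp_apply]
  have h1 : h (f (LinearMap.single K _ x 1)) = g (f.rangeRestrict (LinearMap.single K _ x 1)) :=
    LinearMap.congr_fun hh (f.rangeRestrict (LinearMap.single K _ x 1))
  have h2 := congr_arg Subtype.val
    (LinearMap.congr_fun hg (f.rangeRestrict (LinearMap.single K _ x 1)))
  change f (h (f _)) = f _
  rw [h1]
  exact h2

/-- If the evaluation matrix has a generalized inverse over `D`, forms vanishing at specialized
points are combinations of specializations of forms vanishing at the original points. -/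
lemma mem_span_map_of_eval_eq_zero [Fintype ι] {D k : Type*} [CommRing D] [CommRing k]
    (φ : D →+* k) (v : ι → σ → D) (T : Finset (σ →₀ ℕ)) (B : Matrix T ι D)
    (hB : evalMatrix v T * B * evalMatrix v T = evalMatrix v T)
    {g : MvPolynomial σ k} (hg : g.support ⊆ T) (hgv : ∀ i, eval (φ ∘ v i) g = 0) :
    g ∈ Submodule.span k
      (map φ '' {G | G.support ⊆ T ∧ ∀ i, eval (v i) G = 0}) := by
  classical
  set P : Matrix T T D := 1 - B * evalMatrix v T with hP
  have hgT : g = ∑ m : T, monomial m.1 (coeff m.1 g) := by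
    conv_lhs => rw [g.as_sum]
    rw [Finset.sum_coe_sort T fun m ↦ monomial m (coeff m g)]
    refine Finset.sum_subset hg fun m _ hm ↦ ?_
    rw [notMem_support_iff.1 hm, monomial_zero]
  have hE : ((evalMatrix v T).map φ).mulVec (fun m : T ↦ coeff m.1 g) = 0 := by
    ext i
    rw [evalMatrix_map]
    have := hgv i
    rw [hgT, sum_evalMatrix_mul (fun i ↦ φ ∘ v i)] at this
    exact this
  have hPg : (P.map φ).mulVec (fun m : T ↦ coeff m.1 g) = fun m : T ↦ coeff m.1 g := by
    have : P.map φ = 1 - B.map φ * (evalMatrix v T).map φ := by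
      rw [hP, ← Matrix.map_mul, Matrix.map_sub φ (map_sub φ),
        Matrix.map_one φ (map_zero φ) (map_one φ)]
    rw [this, Matrix.sub_mulVec, Matrix.one_mulVec, ← Matrix.mulVec_mulVec, hE,
      Matrix.mulVec_zero, sub_zero]
  have hEP : evalMatrix v T * P = 0 := by
    rw [hP, Matrix.mul_sub, Matrix.mul_one, ← Matrix.mul_assoc, hB, sub_self]
  have hg' : g = ∑ m : T, coeff m.1 g • map φ (∑ l : T, monomial l.1 (P l m)) := by
    conv_lhs => rw [hgT]
    simp only [map_sum, map_monomial, Finset.smul_sum, smul_monomial]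
    rw [Finset.sum_comm]
    refine Finset.sum_congr rfl fun l _ ↦ ?_
    rw [← map_sum]
    congr 1
    rw [← congr_fun hPg l]
    exact Finset.sum_congr rfl fun m _ ↦ mul_comm _ _
  rw [hg']
  refine Submodule.sum_mem _ fun m _ ↦
    Submodule.smul_mem _ _ (Submodule.subset_span ⟨_, ⟨?_, ?_⟩, rfl⟩)
  · refine (support_sum).trans (Finset.biUnion_subset.2 fun l _ ↦ ?_)
    exact support_monomial_subset.trans (Finset.singleton_subset_iff.2 l.2)
  · intro i
    rw [sum_evalMatrix_mul]
    exact congr_fun (congr_fun hEP i) m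

/-- The exponents of the monomials of degree `e`. -/
def degreeExps (σ : Type*) [Fintype σ] (e : ℕ) : Finset (σ →₀ ℕ) := by
  classical exact Finset.finsuppAntidiag Finset.univ e

lemma mem_degreeExps [Fintype σ] {e : ℕ} {m : σ →₀ ℕ} : m ∈ degreeExps σ e ↔ m.degree = e := by
  classical
  simp [degreeExps, Finset.mem_finsuppAntidiag, Finsupp.degree_eq_sum]

lemma support_subset_degreeExps [Fintype σ] {R : Type*} [CommSemiring R] {e : ℕ}
    {f : MvPolynomial σ R} : f.support ⊆ degreeExps σ e ↔ f.IsHomogeneous e := by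
  constructor
  · intro h m hm
    change Finsupp.weight (fun _ ↦ 1) m = e
    rw [← Finsupp.degree_eq_weight_one]
    exact mem_degreeExps.1 (h (mem_support_iff.2 hm))
  · exact fun h m hm ↦ mem_degreeExps.2
      (not_not.1 fun hne ↦ mem_support_iff.1 hm (h.coeff_eq_zero hne))

/-- Finitely many points over a field specialize to a perfect field of positive characteristic so
that forms of bounded degree vanishing at the points behave well. -/
lemma exists_specialization [Fintype ι] [Fintype σ] {K : Type u} [Field K] (v : ι → σ → K) (N : ℕ)
    {s : Set K} (hs : s.Finite) :
    ∃ (D : Subring K) (k : Type u) (_ : Field k) (p : ℕ) (_ : Fact p.Prime) (_ : CharP k p)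
      (_ : PerfectRing k p) (φ : D →+* k) (w : ι → σ → D), s ⊆ D ∧ (∀ i, D.subtype ∘ w i = v i) ∧
      ∀ e ≤ N, ∀ g : MvPolynomial σ k, g.IsHomogeneous e → (∀ i, eval (φ ∘ w i) g = 0) →
        g ∈ Submodule.span k (map φ '' {G | G.IsHomogeneous e ∧ ∀ i, eval (w i) G = 0}) := by
  choose B hB using fun e ↦ exists_mul_mul_eq (evalMatrix v (degreeExps σ e))
  let S : Set K := s ∪ (Set.range fun x : ι × σ ↦ v x.1 x.2) ∪
    ⋃ e ∈ Set.Iic N, Set.range fun x : degreeExps σ e × ι ↦ B e x.1 x.2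
  have hS : S.Finite := (hs.union (Set.finite_range _)).union
    ((Set.finite_Iic N).biUnion fun _ _ ↦ Set.finite_range _)
  let A := Algebra.adjoin ℤ S
  have hSA : S ⊆ A := Algebra.subset_adjoin
  have hA : Algebra.FiniteType ℤ A := by
    rw [← Subalgebra.fg_iff_finiteType]
    simpa using Subalgebra.fg_adjoin_finset (R := ℤ) hS.toFinset
  obtain ⟨k, hk, p, hp, hkp, hperf, ⟨φ⟩⟩ := exists_ringHom_perfectRing A
  have hv : ∀ i l, v i l ∈ A := fun i l ↦ hSA (Or.inl (Or.inr ⟨(i, l), rfl⟩))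
  refine ⟨A.toSubring, k, hk, p, hp, hkp, hperf, φ, fun i l ↦ ⟨v i l, hv i l⟩,
    fun x hx ↦ hSA (Or.inl (Or.inl hx)), fun i ↦ rfl, fun e he g hg hgv ↦ ?_⟩
  have hBA : ∀ m i, B e m i ∈ A := fun m i ↦
    hSA (Or.inr (Set.mem_biUnion (Set.mem_Iic.2 he) ⟨(m, i), rfl⟩))
  have := mem_span_map_of_eval_eq_zero (D := A.toSubring) φ (fun i l ↦ ⟨v i l, hv i l⟩)
    (degreeExps σ e)
    (Matrix.of fun m i ↦ ⟨B e m i, hBA m i⟩) (by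
      refine Matrix.map_injective (f := A.toSubring.subtype) Subtype.val_injective ?_
      simp only [Matrix.map_mul, evalMatrix_map]
      exact hB e) (support_subset_degreeExps.2 hg) hgv
  simpa only [support_subset_degreeExps] using this

end Specialization

section Transfer

variable {ι K : Type*} [Field K]

attribute [local instance] MvPolynomial.gradedAlgebra

lemma isHomogeneous_pow {σ R : Type*} [CommRing R] {I : Ideal (MvPolynomial σ R)}
    (hI : I.IsHomogeneous (homogeneousSubmodule σ R)) (n : ℕ) :
    (I ^ n).IsHomogeneous (homogeneousSubmodule σ R) := by
  induction n with
  | zero => simpa using Ideal.IsHomogeneous.top _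
  | succ n ih => simpa only [pow_succ] using ih.mul hI

lemma map_lineIdeal_pow_mem {σ D k : Type*} [CommRing D] [CommRing k] (φ : D →+* k) {w : σ → D}
    {j : σ} {t : ℕ} {f : MvPolynomial σ D} (hf : f ∈ lineIdeal w j ^ t) :
    map φ f ∈ lineIdeal (φ ∘ w) j ^ t := by
  rw [← map_lineIdeal, ← Ideal.map_pow]
  exact Ideal.mem_map_of_mem _ hf

lemma exists_map_subtype_eq {σ : Type*} {D : Subring K} {f : MvPolynomial σ K}
    (hf : (f.coeffs : Set K) ⊆ D) : ∃ F : MvPolynomial σ D, map D.subtype F = f := by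
  refine mem_range_map_iff_coeffs_subset.2 (hf.trans fun x hx ↦ ?_)
  exact ⟨⟨x, hx⟩, rfl⟩

lemma isHomogeneous_of_map {σ D : Type*} [CommRing D] {φ : D →+* K}
    (hφ : Function.Injective φ) {f : MvPolynomial σ D} {d : ℕ}
    (hf : (map φ f).IsHomogeneous d) : f.IsHomogeneous d :=
  fun _ hm ↦ hf (by rwa [coeff_map, map_ne_zero_iff _ hφ])

lemma map_mem_formIdeal {σ D k : Type*} [CommRing D] [CommRing k] (φ : D →+* k)
    {w : ι → σ → D} {d : ℕ} :
    formIdeal d w ≤ (formIdeal d fun i ↦ φ ∘ w i).comap (map φ) := by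
  rw [formIdeal, Ideal.span_le]
  rintro g ⟨c, hc, hg, hgw⟩
  refine Ideal.subset_span ⟨c, hc, hg.map φ, fun i ↦ ?_⟩
  rw [← map_eval, hgw, map_zero]

/-- Over an arbitrary field: forms in the `2r`-th symbolic power of the ideal of finitely many
points of the projective plane have large degree. -/
lemma le_degree_of_mem_lineIdeal_pow [Fintype ι] {v : ι → Fin 3 → K} {j : ι → Fin 3}
    (hv : ∀ i, v i (j i) = 1)
    {α : ℕ} (hα0 : 1 ≤ α)
    (hα : ∀ c < α, ∀ g : MvPolynomial (Fin 3) K, g.IsHomogeneous c →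
      (∀ i, eval (v i) g = 0) → g = 0)
    {r d : ℕ} (hr : 1 ≤ r) {f : MvPolynomial (Fin 3) K} (hf : f.IsHomogeneous d) (hf0 : f ≠ 0)
    (hfL : ∀ i, f ∈ lineIdeal (v i) (j i) ^ (2 * r)) : r * (α + 1) ≤ d := by
  obtain ⟨m, hm⟩ := ne_zero_iff.1 hf0
  obtain ⟨D, k, _, p, _, _, _, φ, w, hs, hw, hspan⟩ := exists_specialization v α
    (s := f.coeffs ∪ {(coeff m f)⁻¹}) (Set.toFinite _)
  have hD : Function.Injective D.subtype := Subtype.val_injective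
  obtain ⟨F, rfl⟩ := exists_map_subtype_eq (Set.subset_union_left.trans hs)
  have hwj : ∀ i, w i (j i) = 1 := fun i ↦ hD (by simpa [← hw] using hv i)
  refine le_degree_of_mem_pow_two_mul p (v := fun i ↦ φ ∘ w i)
    (L := fun i ↦ lineIdeal (φ ∘ w i) (j i))
    (fun i f hf ↦ eval_eq_zero_of_mem_lineIdeal (by simp [hwj]) hf)
    (fun i e ↦ pow_two_mul_le_frobPow p (by simp [hwj]) e) hα0 ?_ hr
    (f := map φ F) ((isHomogeneous_of_map hD hf).map φ) ?_ fun i ↦ ?_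
  · intro c hc g hg hgv
    have h1 := hspan c hc.le g hg hgv
    rw [Submodule.span_eq_bot.2, Submodule.mem_bot] at h1
    · exact h1
    · rintro _ ⟨G, ⟨hG, hGw⟩, rfl⟩
      have : map D.subtype G = 0 := hα c hc _ (hG.map _) fun i ↦ by
        rw [← hw, ← map_eval, hGw, map_zero]
      rw [(map_eq_zero_iff _ (map_injective _ hD)).1 this, map_zero]
  · intro h0
    have h1 : coeff m F * ⟨_, hs (Or.inr rfl)⟩ = 1 := hD (by
      rw [map_mul, map_one, ← coeff_map]
      exact mul_inv_cancel₀ hm)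
    have h2 := congr_arg φ h1
    rw [map_mul, ← coeff_map, h0, coeff_zero, zero_mul, map_one] at h2
    exact zero_ne_one h2
  · refine map_lineIdeal_pow_mem φ (mem_lineIdeal_pow_of_map_mem hD (hwj i) ?_)
    rw [hw]
    exact hfL i

lemma eq_zero_of_mem_map {σ D k : Type*} [CommRing D] [CommRing k] (φ : D →+* k)
    (l : MvPolynomial σ k →ₗ[k] k) {I : Ideal (MvPolynomial σ D)}
    (hl : ∀ G ∈ I, l (map φ G) = 0) {x : MvPolynomial σ k} (hx : x ∈ I.map (map φ)) :
    l x = 0 := by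
  suffices h : ∀ m, l (monomial m 1 * x) = 0 by simpa using h 0
  induction hx using Submodule.span_induction with
  | mem x hx =>
    obtain ⟨G, hG, rfl⟩ := hx
    intro m
    have := hl _ (I.mul_mem_left (monomial m 1) hG)
    rwa [map_mul, map_monomial, map_one] at this
  | zero => simp
  | add x y _ _ hx hy =>
    intro m
    rw [mul_add, map_add, hx, hy, add_zero]
  | smul a x _ hx =>
    intro m
    rw [smul_eq_mul, a.as_sum, Finset.sum_mul, Finset.mul_sum, map_sum]
    refine Finset.sum_eq_zero fun μ _ ↦ ?_
    have h1 : monomial (m + μ) (coeff μ a) = coeff μ a • monomial (m + μ) (1 : k) := by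
      rw [smul_monomial, smul_eq_mul, mul_one]
    rw [← mul_assoc, monomial_mul, one_mul, h1, smul_mul_assoc, map_smul, hx, smul_zero]

/-- Over an arbitrary field: forms in the `2r`-th symbolic power of the ideal of finitely many
points of the projective plane lie in the ordinary `r`-th power. -/
lemma mem_formIdeal_pow_of_mem_lineIdeal_pow [Fintype ι] {v : ι → Fin 3 → K} {j : ι → Fin 3}
    (hv : ∀ i, v i (j i) = 1)
    {r d : ℕ} (hr : 1 ≤ r) {f : MvPolynomial (Fin 3) K} (hf : f.IsHomogeneous d)
    (hfL : ∀ i, f ∈ lineIdeal (v i) (j i) ^ (2 * r)) : f ∈ formIdeal d v ^ r := by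
  by_contra hnot
  have hhom : (formIdeal d v ^ r).IsHomogeneous (homogeneousSubmodule (Fin 3) K) :=
    isHomogeneous_pow (Ideal.homogeneous_span _ _ (by
      rintro x ⟨c, _, hx, _⟩
      exact ⟨c, hx⟩)) r
  obtain ⟨l, hl, hlA⟩ := Submodule.exists_le_ker_of_notMem
    (p := (formIdeal d v ^ r).restrictScalars K) hnot
  let T := degreeExps (Fin 3) d
  let c : (Fin 3 →₀ ℕ) → K := fun m ↦ l (monomial m 1) / l f
  have hc : ∀ g : MvPolynomial (Fin 3) K,
      ∑ m ∈ T, c m * coeff m g = l (homogeneousComponent d g) / l f := by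
    intro g
    have : homogeneousComponent d g = ∑ m ∈ T, coeff m g • monomial m 1 := by
      have hsub : (homogeneousComponent d g).support ⊆ T :=
        support_subset_degreeExps.2 (homogeneousComponent_isHomogeneous d g)
      conv_lhs => rw [(homogeneousComponent d g).as_sum]
      rw [Finset.sum_subset hsub fun m _ hm ↦ by rw [notMem_support_iff.1 hm, monomial_zero]]
      refine Finset.sum_congr rfl fun m hm ↦ ?_
      rw [coeff_homogeneousComponent, if_pos (mem_degreeExps.1 hm), smul_monomial, smul_eq_mul,
        mul_one]
    rw [this, map_sum, Finset.sum_div]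
    refine Finset.sum_congr rfl fun m _ ↦ ?_
    rw [map_smul, smul_eq_mul, mul_div_assoc, mul_comm]
  obtain ⟨D, k, _, p, _, _, _, φ, w, hs, hw, hspan⟩ := exists_specialization v d
    (s := f.coeffs ∪ c '' T) (Set.toFinite _)
  have hD : Function.Injective D.subtype := Subtype.val_injective
  obtain ⟨F, rfl⟩ := exists_map_subtype_eq (Set.subset_union_left.trans hs)
  have hwj : ∀ i, w i (j i) = 1 := fun i ↦ hD (by simpa [← hw] using hv i)
  have hFk := mem_formIdeal_pow_of_mem_pow_two_mul p (v := fun i ↦ φ ∘ w i)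
    (L := fun i ↦ lineIdeal (φ ∘ w i) (j i))
    (fun i f hf ↦ eval_eq_zero_of_mem_lineIdeal (by simp [hwj]) hf)
    (fun i e ↦ pow_two_mul_le_frobPow p (by simp [hwj]) e) hr
    (f := map φ F) ((isHomogeneous_of_map hD hf).map φ) fun i ↦ by
      refine map_lineIdeal_pow_mem φ (mem_lineIdeal_pow_of_map_mem hD (hwj i) ?_)
      rw [hw]
      exact hfL i
  have hle : formIdeal d (fun i ↦ φ ∘ w i) ≤ (formIdeal d w).map (map φ) := by
    conv_lhs => rw [formIdeal]
    rw [Ideal.span_le]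
    rintro g ⟨e, he, hg, hgv⟩
    have h1 := hspan e he g hg hgv
    have h2 : Submodule.span k (map φ '' {G | G.IsHomogeneous e ∧ ∀ i, eval (w i) G = 0}) ≤
        ((formIdeal d w).map (map φ)).restrictScalars k := by
      rw [Submodule.span_le]
      rintro _ ⟨G, ⟨hG, hGw⟩, rfl⟩
      exact Ideal.mem_map_of_mem _ (Ideal.subset_span ⟨e, he, hG, hGw⟩)
    exact h2 h1
  have hFmap : map φ F ∈ (formIdeal d w ^ r).map (map φ) := by
    rw [Ideal.map_pow]
    exact Ideal.pow_right_mono hle r hFk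
  have hcD : ∀ m : T, c m ∈ D := fun m ↦ hs (Or.inr ⟨m, m.2, rfl⟩)
  let lk : MvPolynomial (Fin 3) k →ₗ[k] k := ∑ m : T, φ ⟨c m, hcD m⟩ • lcoeff k m.1
  have hlk : ∀ G : MvPolynomial (Fin 3) D,
      lk (map φ G) = φ (∑ m : T, ⟨c m, hcD m⟩ * coeff m.1 G) := fun G ↦ by
    simp [lk, coeff_map]
  have hlD : ∀ G : MvPolynomial (Fin 3) D,
      D.subtype (∑ m : T, ⟨c m, hcD m⟩ * coeff m.1 G) =
        l (homogeneousComponent d (map D.subtype G)) / l (map D.subtype F) := fun G ↦ by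
    rw [← hc, ← Finset.sum_coe_sort T, map_sum]
    simp [coeff_map]
  have h0 : lk (map φ F) = 0 := by
    refine eq_zero_of_mem_map φ lk (fun G hG ↦ ?_) hFmap
    rw [hlk]
    convert map_zero φ
    apply hD
    rw [hlD, map_zero]
    have h1 : map D.subtype G ∈ formIdeal d v ^ r := by
      have h2 := Ideal.mem_map_of_mem (map D.subtype) hG
      rw [Ideal.map_pow] at h2
      refine Ideal.pow_right_mono (Ideal.map_le_iff_le_comap.2 ?_) r h2
      simpa only [hw] using map_mem_formIdeal D.subtype (w := w) (d := d)
    have h2 : l (homogeneousComponent d (map D.subtype G)) = 0 :=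
      hlA (homogeneousComponent_mem_of_mem hhom h1 d)
    rw [h2, zero_div]
  rw [hlk] at h0
  have h1 : (∑ m : T, ⟨c m, hcD m⟩ * coeff m.1 F : D) = 1 := by
    apply hD
    rw [hlD, homogeneousComponent_of_mem hf, if_pos rfl, div_self hl, map_one]
  rw [h1, map_one] at h0
  exact one_ne_zero h0

end Transfer

section MainLemmas

attribute [local instance] MvPolynomial.gradedAlgebra

variable {σ R : Type*} [CommRing R]

lemma eval_smul_of_isHomogeneous {f : MvPolynomial σ R} {d : ℕ} (hf : f.IsHomogeneous d)
    (c : R) (x : σ → R) : eval (c • x) f = c ^ d * eval x f := by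
  rw [eval_eq, eval_eq, Finset.mul_sum]
  refine Finset.sum_congr rfl fun m hm ↦ ?_
  have hd : ∑ i ∈ m.support, m i = d := by
    rw [← Finsupp.degree_apply]
    exact not_not.1 fun h ↦ mem_support_iff.1 hm (hf.coeff_eq_zero h)
  simp only [Pi.smul_apply, smul_eq_mul, mul_pow, Finset.prod_mul_distrib,
    Finset.prod_pow_eq_pow_sum, hd]
  ring

open scoped Pointwise in
lemma exists_span_pow_eq {S : Set (MvPolynomial σ R)} {a : ℕ}
    (hS : ∀ f ∈ S, f.IsHomogeneous a) (n : ℕ) :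
    ∃ T : Set (MvPolynomial σ R), Ideal.span S ^ n = Ideal.span T ∧
      ∀ f ∈ T, f.IsHomogeneous (n * a) := by
  induction n with
  | zero =>
    refine ⟨{1}, by simp, ?_⟩
    rintro f rfl
    simpa using isHomogeneous_one σ R
  | succ n ih =>
    obtain ⟨T, hT, hTa⟩ := ih
    refine ⟨T * S, by rw [pow_succ, hT, Ideal.span_mul_span'], ?_⟩
    rintro _ ⟨t, ht, s, hs, rfl⟩
    rw [add_one_mul]
    exact (hTa t ht).mul (hS s hs)

lemma mem_idealOfVars_pow_mul_span {T : Set (MvPolynomial σ R)} {b t d : ℕ}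
    (hT : ∀ f ∈ T, f.IsHomogeneous b) (hd : b + t ≤ d) {f : MvPolynomial σ R}
    (hf : f.IsHomogeneous d) (hfT : f ∈ Ideal.span T) :
    f ∈ idealOfVars σ R ^ t * Ideal.span T := by
  suffices h : ∀ a, homogeneousComponent d (a * f) ∈ idealOfVars σ R ^ t * Ideal.span T by
    have := h 1
    rwa [one_mul, homogeneousComponent_of_mem hf, if_pos rfl] at this
  clear hf
  induction hfT using Submodule.span_induction with
  | mem x hx =>
    classical
    intro a
    rw [a.as_sum, Finset.sum_mul, map_sum]
    refine Ideal.sum_mem _ fun m _ ↦ ?_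
    have h1 : (monomial m (coeff m a) * x).IsHomogeneous (m.degree + b) :=
      (isHomogeneous_monomial _ rfl).mul (hT x hx)
    rw [homogeneousComponent_of_mem h1]
    split_ifs with h
    · refine Ideal.mul_mem_mul ?_ (Ideal.subset_span hx)
      rw [mem_pow_idealOfVars_iff']
      intro l hl
      rw [coeff_monomial, if_neg]
      rintro rfl
      omega
    · exact Ideal.zero_mem _
  | zero => simp
  | add x y _ _ hx hy =>
    intro a
    rw [mul_add, map_add]
    exact Ideal.add_mem _ (hx a) (hy a)
  | smul c x _ hx =>
    intro a
    rw [smul_eq_mul, ← mul_assoc]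
    exact hx _

variable {K : Type*} [Field K]

lemma isHomogeneous_pointIdeal {N : ℕ} (q : ℙ K (Fin (N + 1) → K)) :
    (pointIdeal q).IsHomogeneous (homogeneousSubmodule (Fin (N + 1)) K) :=
  Ideal.homogeneous_span _ _ fun _ hx ↦ hx.1

lemma pointIdeal_eq_lineIdeal {N : ℕ} (q : ℙ K (Fin (N + 1) → K)) {j : Fin (N + 1)}
    (hj : q.rep j ≠ 0) : pointIdeal q = lineIdeal ((q.rep j)⁻¹ • q.rep) j := by
  apply le_antisymm
  · rw [pointIdeal, Ideal.span_le]
    rintro f ⟨⟨d, hd⟩, hf⟩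
    refine mem_lineIdeal_of_isHomogeneous j hd ?_
    rw [eval_smul_of_isHomogeneous hd, hf, mul_zero]
  · rw [lineIdeal, Ideal.span_le]
    rintro _ ⟨l, rfl⟩
    refine Ideal.subset_span ⟨⟨1, (isHomogeneous_X _ _).sub (isHomogeneous_C_mul_X _ _)⟩, ?_⟩
    simp only [map_sub, map_mul, eval_X, eval_C, Pi.smul_apply, smul_eq_mul]
    field_simp
    simp

lemma mem_mul_of_isHomogeneous {n : ℕ} (hn : 0 < n) (p : Fin n → ℙ K (Fin (2 + 1) → K))
    {S : Set (MvPolynomial (Fin (2 + 1)) K)} (hS : (⨅ i, pointIdeal (p i)) = Ideal.span S)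
    (hSα : ∀ f ∈ S, f.IsHomogeneous (alphaDeg (⨅ i, pointIdeal (p i)))) {t d : ℕ} (ht : 1 ≤ t)
    {f : MvPolynomial (Fin (2 + 1)) K} (hf : f.IsHomogeneous d)
    (hfp : ∀ i, f ∈ pointIdeal (p i) ^ (2 * t)) :
    f ∈ irrIdeal K 2 ^ t * (⨅ i, pointIdeal (p i)) ^ t := by
  rcases eq_or_ne f 0 with rfl | hf0
  · exact Ideal.zero_mem _
  choose j hj using fun i ↦ Function.ne_iff.1 (p i).rep_nonzero
  let v : Fin n → Fin 3 → K := fun i ↦ ((p i).rep (j i))⁻¹ • (p i).rep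
  have hv : ∀ i, v i (j i) = 1 := fun i ↦ inv_mul_cancel₀ (hj i)
  have hpl : ∀ i, pointIdeal (p i) = lineIdeal (v i) (j i) :=
    fun i ↦ pointIdeal_eq_lineIdeal (p i) (hj i)
  set J := ⨅ i, pointIdeal (p i) with hJ
  have hmemJ : ∀ c, ∀ g : MvPolynomial (Fin 3) K, g.IsHomogeneous c →
      (∀ i, eval (v i) g = 0) → g ∈ J := fun c g hg hgv ↦ by
    rw [hJ, Ideal.mem_iInf]
    intro i
    rw [hpl]
    exact mem_lineIdeal_of_isHomogeneous _ hg (hgv i)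
  have hα : ∀ c < alphaDeg J, ∀ g : MvPolynomial (Fin 3) K, g.IsHomogeneous c →
      (∀ i, eval (v i) g = 0) → g = 0 := fun c hc g hg hgv ↦ by
    by_contra hg0
    exact hc.not_ge (Nat.sInf_le ⟨g, hmemJ c g hg hgv, hg0, hg⟩)
  have hfJ : f ∈ J := by
    rw [hJ, Ideal.mem_iInf]
    exact fun i ↦ Ideal.pow_le_self (by omega) (hfp i)
  have hα0 : 1 ≤ alphaDeg J := by
    obtain ⟨g, hg, hg0, hgα⟩ := Nat.sInf_mem (s := {d : ℕ | ∃ f ∈ J, f ≠ 0 ∧ f.IsHomogeneous d})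
      ⟨d, f, hfJ, hf0, hf⟩
    rw [Nat.one_le_iff_ne_zero]
    intro h0
    change g.IsHomogeneous (alphaDeg J) at hgα
    rw [h0] at hgα
    have hgC := totalDegree_eq_zero_iff_eq_C.1 (hgα.totalDegree hg0)
    have hgp := (Ideal.mem_iInf.1 hg) ⟨0, hn⟩
    rw [hpl] at hgp
    have h1 := eval_eq_zero_of_mem_lineIdeal (hv _) hgp
    rw [hgC, eval_C] at h1
    rw [h1, C_0] at hgC
    exact hg0 hgC
  simp only [hpl] at hfp
  have h1 := le_degree_of_mem_lineIdeal_pow hv hα0 hα ht hf hf0 hfp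
  have h2 : f ∈ J ^ t := by
    refine Ideal.pow_right_mono ?_ t (mem_formIdeal_pow_of_mem_lineIdeal_pow hv ht hf hfp)
    rw [formIdeal, Ideal.span_le]
    rintro g ⟨c, _, hg, hgv⟩
    exact hmemJ c g hg hgv
  obtain ⟨T, hT, hTα⟩ := exists_span_pow_eq hSα t
  rw [← hS] at hT
  rw [hT] at h2 ⊢
  exact mem_idealOfVars_pow_mul_span hTα (by linarith) hf h2

end MainLemmas

/-- for points in `ℙ²`, with `J = ⋂ᵢ I(pᵢ)` generated in degree `α(J)`
and `I = J^(m)`, one has `I^(2r) ⊆ M^r I^r` for all `r ≥ 1`. -/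
theorem stmt5 {K : Type*} [Field K] {n : ℕ} (hn : 0 < n)
    (p : Fin n → ℙ K (Fin (2 + 1) → K)) (hinj : Function.Injective p)
    (m : ℕ) (hm : 1 ≤ m)
    (hgen : ∃ S : Set (MvPolynomial (Fin (2 + 1)) K),
      (⨅ i, pointIdeal (p i)) = Ideal.span S ∧
      ∀ f ∈ S, MvPolynomial.IsHomogeneous f (alphaDeg (⨅ i, pointIdeal (p i)))) :
    ∀ r : ℕ, 1 ≤ r →
      (⨅ i, (pointIdeal (p i)) ^ (m * (2 * r))) ≤
        (irrIdeal K 2) ^ r * (⨅ i, (pointIdeal (p i)) ^ m) ^ r := by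
  obtain ⟨S, hS, hSα⟩ := hgen
  intro r hr f hf
  have hle : (irrIdeal K 2) ^ (m * r) * (⨅ i, pointIdeal (p i)) ^ (m * r) ≤
      (irrIdeal K 2) ^ r * (⨅ i, (pointIdeal (p i)) ^ m) ^ r := by
    refine Ideal.mul_mono (Ideal.pow_le_pow_right (Nat.le_mul_of_pos_left r hm)) ?_
    rw [pow_mul]
    exact Ideal.pow_right_mono (le_iInf fun i ↦ Ideal.pow_right_mono (iInf_le _ i) m) r
  rw [← sum_homogeneousComponent f]
  refine Ideal.sum_mem _ fun d _ ↦ hle (mem_mul_of_isHomogeneous hn p hS hSα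
    (Nat.mul_pos hm hr) (homogeneousComponent_isHomogeneous d f) fun i ↦ ?_)
  rw [Nat.mul_left_comm]
  exact homogeneousComponent_mem_of_mem (isHomogeneous_pow (isHomogeneous_pointIdeal (p i)) _)
    (Ideal.mem_iInf.1 hf i) d

end
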